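/- If there exists a collective strategy for the team that guarantees reaching the target set T from the initial state with probability 1 against every strategy of the opponent, then there exists a memoryless collective strategy with the same property. -/

import Mathlib

/-!
Common framework: team concurrent stochastic reachability games.
-/

noncomputable section

/-- A concurrent game structure: finitely many players, finitely many states,
finitely many actions per player, available actions, and a probabilistic
transition function. -/
structure GameStructure where
  Player : Type
  [playerFin : Fintype Player]
  [playerDec : DecidableEq Player]
  State : Type
  [stateFin : Fintype State]
  [stateDec : DecidableEq State]
  Act : Player → Type
  [actFin : ∀ p, Fintype (Act p)]
  [actDec : ∀ p, DecidableEq (Act p)]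
  Av : (p : Player) → State → Finset (Act p)
  av_nonempty : ∀ p s, (Av p s).Nonempty
  trans : State → ((p : Player) → Act p) → State → ℝ
  trans_nonneg : ∀ s a t, 0 ≤ trans s a t
  trans_sum : ∀ s a, ∑ t, trans s a t = 1

attribute [instance] GameStructure.playerFin GameStructure.playerDec
  GameStructure.stateFin GameStructure.stateDec GameStructure.actFin GameStructure.actDec

/-- A (behavioural) strategy of player `p`: a distribution over available
actions, for every history `h` (the list of previously visited states)
and current state `s`. -/
structure Strategy (G : GameStructure) (p : G.Player) where
  toFun : List G.State → G.State → G.Act p → ℝ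
  nonneg : ∀ h s a, 0 ≤ toFun h s a
  support_av : ∀ h s a, a ∉ G.Av p s → toFun h s a = 0
  sum_one : ∀ h s, ∑ a, toFun h s a = 1

/-- A strategy is memoryless if it only depends on the current state. -/
def Strategy.Memoryless {G : GameStructure} {p : G.Player} (σ : Strategy G p) : Prop :=
  ∀ h h' s, σ.toFun h s = σ.toFun h' s

/-- A strategy is deterministic if it always plays a single action with probability 1. -/
def Strategy.Deterministic {G : GameStructure} {p : G.Player} (σ : Strategy G p) : Prop :=
  ∀ h s, ∃ a, σ.toFun h s a = 1

/-- A selector of player `p` at state `s`: a distribution over the available actions. -/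
structure Selector (G : GameStructure) (p : G.Player) (s : G.State) where
  toFun : G.Act p → ℝ
  nonneg : ∀ a, 0 ≤ toFun a
  support_av : ∀ a, a ∉ G.Av p s → toFun a = 0
  sum_one : ∑ a, toFun a = 1

/-- A game: a game structure together with a team, an absorbing target set,
and an initial state. -/
structure Game extends GameStructure where
  team : Finset Player
  target : Finset State
  init : State
  absorbing : ∀ t ∈ target, ∀ a, trans t a t = 1

namespace Game

variable (Gm : Game)

abbrev TeamPlayer := {p : Gm.Player // p ∈ Gm.team}
abbrev OppPlayer := {p : Gm.Player // p ∉ Gm.team}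

/-- A collective strategy: one strategy for each team player. -/
abbrev TeamStrategy := (p : Gm.TeamPlayer) → Strategy Gm.toGameStructure p.1
/-- An opponent strategy: one strategy for each player outside the team. -/
abbrev OppStrategy := (p : Gm.OppPlayer) → Strategy Gm.toGameStructure p.1

abbrev TeamAct := (p : Gm.TeamPlayer) → Gm.Act p.1
abbrev OppAct := (p : Gm.OppPlayer) → Gm.Act p.1

/-- A collective selector at state `s`. -/
abbrev TeamSelector (s : Gm.State) := (p : Gm.TeamPlayer) → Selector Gm.toGameStructure p.1 s

def MemorylessTeam (σ : Gm.TeamStrategy) : Prop := ∀ p, (σ p).Memoryless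
def DeterministicTeam (σ : Gm.TeamStrategy) : Prop := ∀ p, (σ p).Deterministic
def MemorylessOpp (τ : Gm.OppStrategy) : Prop := ∀ p, (τ p).Memoryless

/-- Combine a collective strategy and an opponent strategy into a full profile. -/
def combine (σ : Gm.TeamStrategy) (τ : Gm.OppStrategy) (p : Gm.Player) :
    Strategy Gm.toGameStructure p :=
  if h : p ∈ Gm.team then σ ⟨p, h⟩ else τ ⟨p, h⟩

/-- Combine a joint team action and a joint opponent action into a full action profile. -/
def combineAct (a : Gm.TeamAct) (b : Gm.OppAct) (p : Gm.Player) : Gm.Act p :=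
  if h : p ∈ Gm.team then a ⟨p, h⟩ else b ⟨p, h⟩

/-- A joint opponent action is available at `s`. -/
def OppAvailable (s : Gm.State) (b : Gm.OppAct) : Prop := ∀ p, b p ∈ Gm.Av p.1 s

/-- One-step transition probability, under a full strategy profile, from state `s`
with history `h`, to state `t` (players randomise independently). -/
def stepProb (π : (p : Gm.Player) → Strategy Gm.toGameStructure p)
    (h : List Gm.State) (s t : Gm.State) : ℝ :=
  ∑ a : (p : Gm.Player) → Gm.Act p, (∏ p, (π p).toFun h s (a p)) * Gm.trans s a t

/-- Probability of visiting the target within `n` steps, starting at state `s`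
with history `h`. -/
def reachWithin (π : (p : Gm.Player) → Strategy Gm.toGameStructure p) :
    ℕ → List Gm.State → Gm.State → ℝ
  | 0, _, s => if s ∈ Gm.target then 1 else 0
  | n + 1, h, s =>
      if s ∈ Gm.target then 1
      else ∑ t, Gm.stepProb π h s t * reachWithin π n (h ++ [s]) t

/-- Probability of eventually reaching the target set, starting from state `s`. -/
def reachProbFrom (π : (p : Gm.Player) → Strategy Gm.toGameStructure p) (s : Gm.State) : ℝ :=
  ⨆ n : ℕ, Gm.reachWithin π n [] s

/-- Probability of eventually reaching the target set from the initial state. -/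
def reachProb (π : (p : Gm.Player) → Strategy Gm.toGameStructure p) : ℝ :=
  Gm.reachProbFrom π Gm.init

/-- Probability of visiting the target set for the first time exactly at step `k`. -/
def firstHit (π : (p : Gm.Player) → Strategy Gm.toGameStructure p) :
    ℕ → List Gm.State → Gm.State → ℝ
  | 0, _, s => if s ∈ Gm.target then 1 else 0
  | k + 1, h, s =>
      if s ∈ Gm.target then 0
      else ∑ t, Gm.stepProb π h s t * firstHit π k (h ++ [s]) t

/-- Expected `lam`-discounted payoff from the initial state: the play pays `lam ^ k`
if it first visits the target at step `k`, and `0` if it never visits the target. -/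
def discounted (π : (p : Gm.Player) → Strategy Gm.toGameStructure p) (lam : ℝ) : ℝ :=
  ∑' k : ℕ, lam ^ k * Gm.firstHit π k [] Gm.init

/-- A play (an infinite sequence of states from the initial state) is compatible with
a strategy profile if each of its transitions occurs with positive probability. -/
def CompatiblePlay (π : (p : Gm.Player) → Strategy Gm.toGameStructure p)
    (play : ℕ → Gm.State) : Prop :=
  play 0 = Gm.init ∧
  ∀ n, 0 < Gm.stepProb π (List.ofFn fun i : Fin n => play i.1) (play n) (play (n + 1))

/-- Expected value of the valuation `v` at the successor of `s`, when the team plays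
according to the collective selector `ξ` and the opponent plays the joint action `b`. -/
def preTeamAct (v : Gm.State → ℝ) (s : Gm.State) (ξ : Gm.TeamSelector s) (b : Gm.OppAct) : ℝ :=
  ∑ a : Gm.TeamAct, (∏ p, (ξ p).toFun (a p)) * ∑ t, Gm.trans s (Gm.combineAct a b) t * v t

/-- An opponent selector at state `s`: a distribution over available joint opponent actions. -/
structure OppSelector (s : Gm.State) where
  toFun : Gm.OppAct → ℝ
  nonneg : ∀ b, 0 ≤ toFun b
  support_av : ∀ b, ¬ Gm.OppAvailable s b → toFun b = 0
  sum_one : ∑ b, toFun b = 1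

/-- Expected value of `v` at the successor of `s` under a collective selector `ξ`
and an opponent selector `ζ`. -/
def preSel (v : Gm.State → ℝ) (s : Gm.State) (ξ : Gm.TeamSelector s) (ζ : Gm.OppSelector s) : ℝ :=
  ∑ b, ζ.toFun b * Gm.preTeamAct v s ξ b

/-- The predecessor operator: best one-step value the team can guarantee. -/
def pre (v : Gm.State → ℝ) (s : Gm.State) : ℝ :=
  ⨆ ξ : Gm.TeamSelector s, ⨅ ζ : Gm.OppSelector s, Gm.preSel v s ξ ζ

/-- The value iteration sequence: `vIter 0` is the indicator of the target set
and `vIter (n+1) = pre (vIter n)`. -/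
def vIter : ℕ → Gm.State → ℝ
  | 0 => fun s => if s ∈ Gm.target then 1 else 0
  | n + 1 => Gm.pre (vIter n)

/-- The max-min value of the game started at `s`. -/
def maxminFrom (s : Gm.State) : ℝ :=
  ⨆ σ : Gm.TeamStrategy, ⨅ τ : Gm.OppStrategy, Gm.reachProbFrom (Gm.combine σ τ) s

/-- The set of states from which the team can win almost surely. -/
def winSet : Set Gm.State :=
  {s | ∃ σ : Gm.TeamStrategy, ∀ τ : Gm.OppStrategy, Gm.reachProbFrom (Gm.combine σ τ) s = 1}

/-- Distribution of the successor of `s` when the team plays the collective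
selector `ξ` and the opponent plays the joint action `b`. -/
def succProbSel (s : Gm.State) (ξ : Gm.TeamSelector s) (b : Gm.OppAct) (t : Gm.State) : ℝ :=
  ∑ a : Gm.TeamAct, (∏ p, (ξ p).toFun (a p)) * Gm.trans s (Gm.combineAct a b) t

/-- Distribution of the successor of `s` (with history `h`) when the team plays the
collective strategy `σ` and the opponent plays the joint action `b`. -/
def succProbTeam (σ : Gm.TeamStrategy) (h : List Gm.State) (s : Gm.State)
    (b : Gm.OppAct) (t : Gm.State) : ℝ :=
  ∑ a : Gm.TeamAct, (∏ p, (σ p).toFun h s (a p)) * Gm.trans s (Gm.combineAct a b) t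

/-- The layered decomposition of the almost-sure winning set. -/
def wSeq : ℕ → Set Gm.State
  | 0 => ↑Gm.target
  | k + 1 =>
      wSeq k ∪
      {s ∈ Gm.winSet | ∃ ξ : Gm.TeamSelector s, ∀ b : Gm.OppAct, Gm.OppAvailable s b →
        (0 < ∑ t, (wSeq k).indicator (Gm.succProbSel s ξ b) t) ∧
        (∑ t, Gm.winSet.indicator (Gm.succProbSel s ξ b) t = 1)}

end Game

namespace Game

variable {Gm : Game}

section Profiles

variable (π : (p : Gm.Player) → Strategy Gm.toGameStructure p)

theorem stepProb_nonneg (h : List Gm.State) (s t : Gm.State) : 0 ≤ Gm.stepProb π h s t :=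
  Finset.sum_nonneg fun a _ =>
    mul_nonneg (Finset.prod_nonneg fun p _ => (π p).nonneg h s (a p)) (Gm.trans_nonneg s a t)

theorem sum_stepProb (h : List Gm.State) (s : Gm.State) : ∑ t, Gm.stepProb π h s t = 1 := by
  simp only [stepProb]
  rw [Finset.sum_comm]
  simp only [← Finset.mul_sum, Gm.trans_sum, mul_one]
  rw [← Fintype.prod_sum]
  simp [(π _).sum_one]

theorem reachWithin_of_mem {s : Gm.State} (hs : s ∈ Gm.target) (n : ℕ) (h : List Gm.State) :
    Gm.reachWithin π n h s = 1 := by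
  cases n <;> simp [reachWithin, hs]

theorem reachWithin_zero_of_notMem {s : Gm.State} (hs : s ∉ Gm.target) (h : List Gm.State) :
    Gm.reachWithin π 0 h s = 0 := by
  simp [reachWithin, hs]

theorem reachWithin_succ_of_notMem {s : Gm.State} (hs : s ∉ Gm.target) (n : ℕ)
    (h : List Gm.State) :
    Gm.reachWithin π (n + 1) h s =
      ∑ t, Gm.stepProb π h s t * Gm.reachWithin π n (h ++ [s]) t := by
  simp [reachWithin, hs]

theorem reachWithin_nonneg (n : ℕ) (h : List Gm.State) (s : Gm.State) :
    0 ≤ Gm.reachWithin π n h s := by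
  induction n generalizing h s with
  | zero => simp only [reachWithin]; split_ifs <;> norm_num
  | succ n ih =>
    simp only [reachWithin]
    split_ifs
    · norm_num
    · exact Finset.sum_nonneg fun t _ => mul_nonneg (stepProb_nonneg π h s t) (ih _ _)

theorem reachWithin_le_one (n : ℕ) (h : List Gm.State) (s : Gm.State) :
    Gm.reachWithin π n h s ≤ 1 := by
  induction n generalizing h s with
  | zero => simp only [reachWithin]; split_ifs <;> norm_num
  | succ n ih =>
    simp only [reachWithin]
    split_ifs
    · norm_num
    · rw [← sum_stepProb π h s]
      exact Finset.sum_le_sum fun t _ =>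
        mul_le_of_le_one_right (stepProb_nonneg π h s t) (ih _ _)

theorem one_sub_reachWithin_succ {s : Gm.State} (hs : s ∉ Gm.target) (n : ℕ)
    (h : List Gm.State) :
    1 - Gm.reachWithin π (n + 1) h s =
      ∑ t, Gm.stepProb π h s t * (1 - Gm.reachWithin π n (h ++ [s]) t) := by
  simp only [reachWithin_succ_of_notMem π hs, mul_sub, mul_one, Finset.sum_sub_distrib,
    sum_stepProb]

/-- If, everywhere on a set closed under the moves of the profile, the target is missed for `n`
steps with probability at most `ε`, then missing it for `n` further steps costs a factor `ε`. -/
theorem one_sub_reachWithin_add_le {W : Set Gm.State}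
    (hW : ∀ s ∈ W, s ∉ Gm.target → ∀ h t, 0 < Gm.stepProb π h s t → t ∈ W)
    {n : ℕ} {ε : ℝ} (hε : ∀ s ∈ W, ∀ h, 1 - Gm.reachWithin π n h s ≤ ε)
    (j : ℕ) {s : Gm.State} (hs : s ∈ W) (h : List Gm.State) :
    1 - Gm.reachWithin π (j + n) h s ≤ ε * (1 - Gm.reachWithin π j h s) := by
  by_cases hT : s ∈ Gm.target
  · simp [reachWithin_of_mem π hT]
  induction j generalizing s h with
  | zero =>
    rw [reachWithin_zero_of_notMem π hT]
    simpa using hε s hs h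
  | succ j ih =>
    rw [Nat.add_right_comm, one_sub_reachWithin_succ π hT, one_sub_reachWithin_succ π hT,
      Finset.mul_sum]
    refine Finset.sum_le_sum fun t _ => ?_
    rw [mul_left_comm]
    rcases (stepProb_nonneg π h s t).eq_or_lt with h0 | h0
    · simp [← h0]
    · refine mul_le_mul_of_nonneg_left ?_ h0.le
      by_cases htT : t ∈ Gm.target
      · simp [reachWithin_of_mem π htT]
      · exact ih (hW s hs hT h t h0) _ htT

/-- A set closed under the moves of the profile, from which the target is reached within `n` steps
with probability bounded below, reaches the target almost surely. -/
theorem exists_lt_reachWithin_of_uniform {W : Set Gm.State}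
    (hW : ∀ s ∈ W, s ∉ Gm.target → ∀ h t, 0 < Gm.stepProb π h s t → t ∈ W)
    {n : ℕ} {c : ℝ} (hc : 0 < c) (hn : ∀ s ∈ W, ∀ h, c ≤ Gm.reachWithin π n h s)
    {s : Gm.State} (hs : s ∈ W) (h : List Gm.State) {x : ℝ} (hx : x < 1) :
    ∃ m, x < Gm.reachWithin π m h s := by
  have hc1 : c ≤ 1 := (hn s hs h).trans (reachWithin_le_one π n h s)
  have key : ∀ m : ℕ, ∀ t ∈ W, ∀ h', 1 - Gm.reachWithin π (m * n) h' t ≤ (1 - c) ^ m := by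
    intro m
    induction m with
    | zero =>
      intro t _ h'
      have := reachWithin_nonneg π (0 * n) h' t
      simp only [pow_zero]
      linarith
    | succ m ih =>
      intro t ht h'
      have h1 := one_sub_reachWithin_add_le π hW ih n ht h'
      rw [Nat.add_comm n, ← Nat.succ_mul] at h1
      rw [pow_succ]
      refine h1.trans (mul_le_mul_of_nonneg_left ?_ (pow_nonneg (by linarith) m))
      have := hn t ht h'
      linarith
  obtain ⟨m, hm⟩ := exists_pow_lt_of_lt_one (sub_pos.2 hx) (by linarith : 1 - c < 1)
  refine ⟨m * n, ?_⟩
  have := key m s hs h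
  linarith

theorem reachWithin_congr {π π' : (p : Gm.Player) → Strategy Gm.toGameStructure p} {k : ℕ}
    (hπ : ∀ p h s, k ≤ h.length → (π p).toFun h s = (π' p).toFun h s)
    (n : ℕ) (h : List Gm.State) (hk : k ≤ h.length) (s : Gm.State) :
    Gm.reachWithin π n h s = Gm.reachWithin π' n h s := by
  induction n generalizing h s with
  | zero => rfl
  | succ n ih =>
    simp only [reachWithin, stepProb, hπ _ h s hk]
    congr 1
    refine Finset.sum_congr rfl fun t _ => ?_
    rw [ih (h ++ [s]) (by simp; omega) t]

end Profiles

theorem succProbTeam_nonneg (σ : Gm.TeamStrategy) (h : List Gm.State) (s : Gm.State)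
    (b : Gm.OppAct) (t : Gm.State) : 0 ≤ Gm.succProbTeam σ h s b t :=
  Finset.sum_nonneg fun a _ =>
    mul_nonneg (Finset.prod_nonneg fun p _ => (σ p).nonneg h s (a p)) (Gm.trans_nonneg s _ t)

theorem stepProb_combine (σ : Gm.TeamStrategy) (τ : Gm.OppStrategy) (h : List Gm.State)
    (s t : Gm.State) :
    Gm.stepProb (Gm.combine σ τ) h s t =
      ∑ b : Gm.OppAct, (∏ p, (τ p).toFun h s (b p)) * Gm.succProbTeam σ h s b t := by
  simp only [stepProb, succProbTeam, Finset.mul_sum]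
  rw [Finset.sum_comm, ← Fintype.sum_prod_type',
    ← (Equiv.piEquivPiSubtypeProd (fun p => p ∈ Gm.team) Gm.Act).symm.sum_comp]
  refine Finset.sum_congr rfl fun x _ => ?_
  have hact : (Equiv.piEquivPiSubtypeProd (fun p => p ∈ Gm.team) Gm.Act).symm x
      = Gm.combineAct x.1 x.2 := rfl
  rw [hact, ← Fintype.prod_subtype_mul_prod_subtype (fun p => p ∈ Gm.team)]
  have h1 : ∀ p : Gm.TeamPlayer, (Gm.combine σ τ p.1).toFun h s (Gm.combineAct x.1 x.2 p.1)
      = (σ p).toFun h s (x.1 p) := by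
    intro p; simp [combine, combineAct, p.2]
  have h2 : ∀ p : Gm.OppPlayer, (Gm.combine σ τ p.1).toFun h s (Gm.combineAct x.1 x.2 p.1)
      = (τ p).toFun h s (x.2 p) := by
    intro p; simp [combine, combineAct, p.2]
  simp only [h1, h2]
  rw [mul_left_comm, ← mul_assoc]
  congr!

theorem sum_oppProb (τ : Gm.OppStrategy) (h : List Gm.State) (s : Gm.State) :
    ∑ b : Gm.OppAct, ∏ p, (τ p).toFun h s (b p) = 1 := by
  rw [← Fintype.prod_sum]
  simp [(τ _).sum_one]

theorem oppAvailable_of_prod_ne_zero {τ : Gm.OppStrategy} {h : List Gm.State} {s : Gm.State}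
    {b : Gm.OppAct} (hb : ∏ p, (τ p).toFun h s (b p) ≠ 0) : Gm.OppAvailable s b := by
  intro p
  by_contra hp
  exact hb (Finset.prod_eq_zero (Finset.mem_univ p) ((τ p).support_av h s _ hp))

theorem exists_succProbTeam_pos {σ : Gm.TeamStrategy} {τ : Gm.OppStrategy} {h : List Gm.State}
    {s t : Gm.State} (hp : 0 < Gm.stepProb (Gm.combine σ τ) h s t) :
    ∃ b, Gm.OppAvailable s b ∧ 0 < Gm.succProbTeam σ h s b t := by
  rw [stepProb_combine] at hp
  obtain ⟨b, -, hb⟩ := Finset.exists_ne_zero_of_sum_ne_zero hp.ne'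
  exact ⟨b, oppAvailable_of_prod_ne_zero (left_ne_zero_of_mul hb),
    (succProbTeam_nonneg σ h s b t).lt_of_ne' (right_ne_zero_of_mul hb)⟩

/-- The opponent strategy that plays the actions prescribed by `β` wherever they are available. -/
def pureOpp (β : List Gm.State → Gm.State → Gm.OppAct) : Gm.OppStrategy := fun p =>
  { toFun := fun h s a =>
      if a = (if β h s p ∈ Gm.Av p.1 s then β h s p else (Gm.av_nonempty p.1 s).choose)
      then 1 else 0
    nonneg := fun h s a => by split_ifs <;> norm_num
    support_av := fun h s a ha => by
      refine if_neg fun hEq => ha ?_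
      rw [hEq]
      split_ifs with hβ
      · exact hβ
      · exact (Gm.av_nonempty p.1 s).choose_spec
    sum_one := fun h s => by simp }

/-- The opponent strategy that follows `τ₁` on histories of length at most `n` and `τ₂` later. -/
def switchOpp (n : ℕ) (τ₁ τ₂ : Gm.OppStrategy) : Gm.OppStrategy := fun p =>
  { toFun := fun h s => if h.length ≤ n then (τ₁ p).toFun h s else (τ₂ p).toFun h s
    nonneg := fun h s a => by
      split_ifs
      exacts [(τ₁ p).nonneg h s a, (τ₂ p).nonneg h s a]
    support_av := fun h s a ha => by
      split_ifs
      exacts [(τ₁ p).support_av h s a ha, (τ₂ p).support_av h s a ha]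
    sum_one := fun h s => by
      split_ifs
      exacts [(τ₁ p).sum_one h s, (τ₂ p).sum_one h s] }

theorem stepProb_combine_of_pure {σ : Gm.TeamStrategy} {τ : Gm.OppStrategy}
    {β : List Gm.State → Gm.State → Gm.OppAct} {h : List Gm.State} {s : Gm.State}
    (hτ : ∀ p, (τ p).toFun h s = (pureOpp β p).toFun h s)
    (hβ : Gm.OppAvailable s (β h s)) (t : Gm.State) :
    Gm.stepProb (Gm.combine σ τ) h s t = Gm.succProbTeam σ h s (β h s) t := by
  rw [stepProb_combine, Finset.sum_eq_single (β h s)]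
  · rw [Finset.prod_eq_one, one_mul]
    intro p _
    simp [hτ, pureOpp, hβ p]
  · intro b _ hb
    obtain ⟨p, hp⟩ := Function.ne_iff.1 hb
    rw [Finset.prod_eq_zero (Finset.mem_univ p), zero_mul]
    simp [hτ, pureOpp, hβ p, hp]
  · simp

/-- `σ` reaches the target almost surely from `s` with history `h`, against every opponent. -/
def WinsAt (σ : Gm.TeamStrategy) (h : List Gm.State) (s : Gm.State) : Prop :=
  ∀ τ : Gm.OppStrategy, ∀ x < 1, ∃ n, x < Gm.reachWithin (Gm.combine σ τ) n h s

theorem winsAt_nil_iff {σ : Gm.TeamStrategy} {s : Gm.State} :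
    WinsAt σ [] s ↔ ∀ τ : Gm.OppStrategy, Gm.reachProbFrom (Gm.combine σ τ) s = 1 := by
  refine forall_congr' fun τ => ⟨fun hx => ?_, fun hx x hlt => ?_⟩
  · exact ciSup_eq_of_forall_le_of_forall_lt_exists_gt
      (fun n => reachWithin_le_one _ n [] s) hx
  · rw [← hx] at hlt
    exact exists_lt_of_lt_ciSup hlt

theorem WinsAt.step {σ : Gm.TeamStrategy} {h : List Gm.State} {s : Gm.State}
    (hw : WinsAt σ h s) (hs : s ∉ Gm.target) {b : Gm.OppAct} (hb : Gm.OppAvailable s b)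
    {t : Gm.State} (ht : 0 < Gm.succProbTeam σ h s b t) : WinsAt σ (h ++ [s]) t := by
  intro τ x hx
  by_contra! hle
  let τ' : Gm.OppStrategy := switchOpp h.length (pureOpp fun _ _ => b) τ
  have hstep : ∀ u, Gm.stepProb (Gm.combine σ τ') h s u = Gm.succProbTeam σ h s b u :=
    stepProb_combine_of_pure (β := fun _ _ => b) (fun p => by simp [τ', switchOpp]) hb
  have hlater : ∀ n, Gm.reachWithin (Gm.combine σ τ') n (h ++ [s]) t ≤ x := by
    intro n
    refine le_of_eq_of_le (reachWithin_congr (k := h.length + 1) ?_ n _ (by simp) t) (hle n)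
    intro p h' s' hk
    by_cases hp : p ∈ Gm.team
    · simp [combine, hp]
    · simp [combine, hp, τ', switchOpp, Nat.not_le.2 (Nat.lt_of_succ_le hk)]
  obtain ⟨n, hn⟩ := hw τ' (max 0 (1 - Gm.succProbTeam σ h s b t * (1 - x)))
    (max_lt one_pos (by nlinarith))
  rw [max_lt_iff] at hn
  cases n with
  | zero => exact hn.1.ne' (reachWithin_zero_of_notMem _ hs h)
  | succ n =>
    have h1 := one_sub_reachWithin_succ (Gm.combine σ τ') hs n h
    have h2 := Finset.single_le_sum (f := fun u => Gm.stepProb (Gm.combine σ τ') h s u *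
        (1 - Gm.reachWithin (Gm.combine σ τ') n (h ++ [s]) u))
      (fun u _ => mul_nonneg (stepProb_nonneg _ h s u)
        (sub_nonneg.2 (reachWithin_le_one _ n _ u))) (Finset.mem_univ t)
    rw [← h1] at h2
    simp only [hstep] at h2
    have h3 := mul_le_mul_of_nonneg_left (sub_le_sub_left (hlater n) 1) ht.le
    linarith [hn.2]

/-- The states from which some collective strategy wins almost surely after some history. -/
def almostSureSet (Gm : Game) : Set Gm.State := {s | ∃ σ h, WinsAt (Gm := Gm) σ h s}

/-- The states from which the team can force, with positive probability, to reach the target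
within `k` steps while surely staying in `almostSureSet`. -/
def attractor (Gm : Game) : ℕ → Set Gm.State
  | 0 => ↑Gm.target
  | k + 1 => {s | s ∈ attractor Gm k ∨
      ∃ ξ : Gm.TeamSelector s, ∀ b, Gm.OppAvailable s b →
        (∃ t ∈ attractor Gm k, 0 < Gm.succProbSel s ξ b t) ∧
        ∀ t, 0 < Gm.succProbSel s ξ b t → t ∈ Gm.almostSureSet}

theorem attractor_mono (Gm : Game) : Monotone Gm.attractor :=
  monotone_nat_of_le_succ fun _ _ hs => Or.inl hs

/-- The collective selector used by a strategy at a given history. -/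
def selectorAt (σ : Gm.TeamStrategy) (h : List Gm.State) (s : Gm.State) : Gm.TeamSelector s :=
  fun p => ⟨(σ p).toFun h s, (σ p).nonneg h s, (σ p).support_av h s, (σ p).sum_one h s⟩

/-- The memoryless collective strategy given by a choice of selectors. -/
def memorylessOf (ξ : ∀ s : Gm.State, Gm.TeamSelector s) : Gm.TeamStrategy := fun p =>
  ⟨fun _ s => (ξ s p).toFun, fun _ s => (ξ s p).nonneg, fun _ s => (ξ s p).support_av,
    fun _ s => (ξ s p).sum_one⟩

theorem nonempty_oppAct (s : Gm.State) : Nonempty Gm.OppAct :=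
  ⟨fun p => (Gm.av_nonempty p.1 s).choose⟩

theorem exists_mem_attractor {s₀ : Gm.State} (hs₀ : s₀ ∈ Gm.almostSureSet) :
    ∃ k, s₀ ∈ Gm.attractor k := by
  classical
  obtain ⟨σ, h₀, hw₀⟩ := hs₀
  by_contra hbad₀
  have := nonempty_oppAct s₀
  have escape : ∀ h s, WinsAt σ h s → (¬ ∃ k, s ∈ Gm.attractor k) →
      ∃ b, Gm.OppAvailable s b ∧
        ∀ t, 0 < Gm.succProbTeam σ h s b t → ¬ ∃ k, t ∈ Gm.attractor k := by
    intro h s hw hbad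
    by_contra! hcon
    have hT : s ∉ Gm.target := fun hT => hbad ⟨0, hT⟩
    have hrank : ∀ b, ∃ k, Gm.OppAvailable s b →
        ∃ t ∈ Gm.attractor k, 0 < Gm.succProbTeam σ h s b t := by
      intro b
      by_cases hb : Gm.OppAvailable s b
      · obtain ⟨t, ht, k, hk⟩ := hcon b hb
        exact ⟨k, fun _ => ⟨t, hk, ht⟩⟩
      · exact ⟨0, fun hb' => absurd hb' hb⟩
    choose k hk using hrank
    obtain ⟨K, hK⟩ := (Set.finite_range k).bddAbove
    refine hbad ⟨K + 1, Or.inr ⟨selectorAt σ h s, fun b hb => ⟨?_, fun t ht => ?_⟩⟩⟩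
    · obtain ⟨t, ht, hpos⟩ := hk b hb
      exact ⟨t, attractor_mono Gm (hK ⟨b, rfl⟩) ht, hpos⟩
    · exact ⟨σ, h ++ [s], hw.step hT hb ht⟩
  choose! β hβ using escape
  have hzero : ∀ n h s, WinsAt σ h s → (¬ ∃ k, s ∈ Gm.attractor k) →
      Gm.reachWithin (Gm.combine σ (pureOpp β)) n h s = 0 := by
    intro n
    induction n with
    | zero => exact fun h s _ hbad => reachWithin_zero_of_notMem _ (fun hT => hbad ⟨0, hT⟩) h
    | succ n ih =>
      intro h s hw hbad
      have hT : s ∉ Gm.target := fun hT => hbad ⟨0, hT⟩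
      obtain ⟨hav, hesc⟩ := hβ h s hw hbad
      rw [reachWithin_succ_of_notMem _ hT]
      refine Finset.sum_eq_zero fun t _ => ?_
      rw [stepProb_combine_of_pure (fun _ => rfl) hav]
      rcases (succProbTeam_nonneg σ h s (β h s) t).eq_or_lt with h0 | h0
      · rw [← h0, zero_mul]
      · rw [ih _ _ (hw.step hT hav h0) (hesc t h0), mul_zero]
  obtain ⟨n, hn⟩ := hw₀ (pureOpp β) 0 one_pos
  exact hn.ne' (hzero n h₀ s₀ hw₀ hbad₀)

/-- The first layer of the attractor containing a state. -/
def attractorRank (s : Gm.State) : ℕ := sInf {k | s ∈ Gm.attractor k}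

theorem mem_attractor_rank {s : Gm.State} (hs : s ∈ Gm.almostSureSet) :
    s ∈ Gm.attractor (attractorRank s) :=
  Nat.sInf_mem (s := {k | s ∈ Gm.attractor k}) (exists_mem_attractor hs)

theorem exists_progress_selector {s : Gm.State} (hs : s ∈ Gm.almostSureSet)
    (hT : s ∉ Gm.target) :
    ∃ ξ : Gm.TeamSelector s, ∀ b, Gm.OppAvailable s b →
      (∃ t, attractorRank t < attractorRank s ∧ 0 < Gm.succProbSel s ξ b t) ∧
      ∀ t, 0 < Gm.succProbSel s ξ b t → t ∈ Gm.almostSureSet := by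
  have hmem := mem_attractor_rank hs
  rcases hk : attractorRank s with _ | k
  · rw [hk] at hmem
    exact absurd hmem hT
  · rw [hk] at hmem
    rcases hmem with hmem | ⟨ξ, hξ⟩
    · have : attractorRank s ≤ k := Nat.sInf_le hmem
      omega
    · refine ⟨ξ, fun b hb => ⟨?_, (hξ b hb).2⟩⟩
      obtain ⟨t, ht, hpos⟩ := (hξ b hb).1
      exact ⟨t, Nat.lt_succ_of_le (Nat.sInf_le ht), hpos⟩

theorem exists_le_succProbSel (ξ : ∀ s : Gm.State, Gm.TeamSelector s) :
    ∃ δ : ℝ, 0 < δ ∧ ∀ s b t, 0 < Gm.succProbSel s (ξ s) b t →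
      δ ≤ Gm.succProbSel s (ξ s) b t := by
  have : Nonempty Gm.State := ⟨Gm.init⟩
  have := nonempty_oppAct Gm.init
  let f : Gm.State × Gm.OppAct × Gm.State → ℝ := fun x =>
    if 0 < Gm.succProbSel x.1 (ξ x.1) x.2.1 x.2.2 then Gm.succProbSel x.1 (ξ x.1) x.2.1 x.2.2
    else 1
  obtain ⟨x₀, hx₀⟩ := Finite.exists_min f
  refine ⟨f x₀, ?_, fun s b t hpos => (hx₀ (s, b, t)).trans (by simp [f, hpos])⟩
  simp only [f]
  split_ifs with hpos
  exacts [hpos, one_pos]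

theorem exists_memoryless_winsAt (Gm : Game) :
    ∃ σ : Gm.TeamStrategy, Gm.MemorylessTeam σ ∧
      ∀ s ∈ Gm.almostSureSet, ∀ h, WinsAt σ h s := by
  classical
  have hex : ∀ s : Gm.State, ∃ ξ : Gm.TeamSelector s,
      s ∈ Gm.almostSureSet → s ∉ Gm.target → ∀ b, Gm.OppAvailable s b →
      (∃ t, attractorRank t < attractorRank s ∧ 0 < Gm.succProbSel s ξ b t) ∧
      ∀ t, 0 < Gm.succProbSel s ξ b t → t ∈ Gm.almostSureSet := by
    intro s
    by_cases hs : s ∈ Gm.almostSureSet ∧ s ∉ Gm.target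
    · obtain ⟨ξ, hξ⟩ := exists_progress_selector hs.1 hs.2
      exact ⟨ξ, fun _ _ => hξ⟩
    · refine ⟨fun p => ⟨fun a => if a = (Gm.av_nonempty p.1 s).choose then 1 else 0,
        fun a => by split_ifs <;> norm_num, fun a ha => if_neg fun hEq => ha ?_, by simp⟩,
        fun h1 h2 => absurd ⟨h1, h2⟩ hs⟩
      exact hEq ▸ (Gm.av_nonempty p.1 s).choose_spec
  choose ξ hξ using hex
  obtain ⟨δ, hδ, hmin⟩ := exists_le_succProbSel ξ
  refine ⟨memorylessOf ξ, fun p h h' s => rfl, fun s₀ hs₀ h₀ τ x hx => ?_⟩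
  set π := Gm.combine (memorylessOf ξ) τ with hπ
  have hclosed : ∀ s ∈ Gm.almostSureSet, s ∉ Gm.target → ∀ h t,
      0 < Gm.stepProb π h s t → t ∈ Gm.almostSureSet := by
    intro s hs hT h t hpos
    obtain ⟨b, hb, hb'⟩ := exists_succProbTeam_pos hpos
    exact (hξ s hs hT b hb).2 t hb'
  let c : ℝ := min δ 1
  have hc : 0 < c := lt_min hδ one_pos
  have hlow : ∀ k, ∀ s ∈ Gm.almostSureSet, attractorRank s ≤ k → ∀ h,
      c ^ k ≤ Gm.reachWithin π k h s := by
    intro k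
    induction k with
    | zero =>
      intro s hs hk h
      have hmem := mem_attractor_rank hs
      rw [Nat.le_zero.1 hk] at hmem
      rw [reachWithin_of_mem π hmem, pow_zero]
    | succ k ih =>
      intro s hs hk h
      by_cases hT : s ∈ Gm.target
      · rw [reachWithin_of_mem π hT]
        exact pow_le_one₀ hc.le (min_le_right _ _)
      rw [reachWithin_succ_of_notMem π hT]
      simp only [hπ, stepProb_combine, Finset.sum_mul]
      rw [Finset.sum_comm, ← one_mul (c ^ (k + 1)), ← sum_oppProb τ h s, Finset.sum_mul]
      refine Finset.sum_le_sum fun b _ => ?_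
      simp only [mul_assoc]
      rw [← Finset.mul_sum]
      have hw : 0 ≤ ∏ p, (τ p).toFun h s (b p) :=
        Finset.prod_nonneg fun p _ => (τ p).nonneg h s (b p)
      rcases hw.eq_or_lt with h0 | h0
      · simp [← h0]
      refine mul_le_mul_of_nonneg_left ?_ hw
      obtain ⟨⟨t, hrank, hpos⟩, hsafe⟩ := hξ s hs hT b (oppAvailable_of_prod_ne_zero h0.ne')
      refine le_trans ?_ (Finset.single_le_sum
        (fun u _ => mul_nonneg (succProbTeam_nonneg _ h s b u) (reachWithin_nonneg _ k _ u))
        (Finset.mem_univ t))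
      rw [pow_succ']
      exact mul_le_mul ((min_le_left _ _).trans (hmin s b t hpos))
        (ih t (hsafe t hpos) (by omega) _) (pow_nonneg hc.le k) hpos.le
  obtain ⟨K, hK⟩ := (Set.finite_range (attractorRank (Gm := Gm))).bddAbove
  exact exists_lt_reachWithin_of_uniform π hclosed (pow_pos hc K)
    (fun s hs h => hlow K s hs (hK ⟨s, rfl⟩) h) hs₀ h₀ hx

end Game

/-- If some collective strategy guarantees reaching the target with
probability 1 against every opponent strategy, then some memoryless collective
strategy does as well. -/
theorem almost_sure_memoryless_sufficient (Gm : Game)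
    (h : ∃ σ : Gm.TeamStrategy, ∀ τ : Gm.OppStrategy, Gm.reachProb (Gm.combine σ τ) = 1) :
    ∃ σ : Gm.TeamStrategy, Gm.MemorylessTeam σ ∧
      ∀ τ : Gm.OppStrategy, Gm.reachProb (Gm.combine σ τ) = 1 := by
  obtain ⟨σ, hσ⟩ := h
  obtain ⟨σ', hmem, hwin⟩ := Game.exists_memoryless_winsAt Gm
  exact ⟨σ', hmem, Game.winsAt_nil_iff.1
    (hwin Gm.init ⟨σ, [], Game.winsAt_nil_iff.2 hσ⟩ [])⟩
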